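/- Let x be a string of length n over the alphabet {c_1, …, c_σ} with c_1 ≺ ⋯ ≺ c_σ that is a necklace (x is the lexicographically smallest among its cyclic rotations), let (e_1, …, e_σ) be the Parikh vector of x, let y = c_1^{e_1} ⋯ c_σ^{e_σ} be the lexicographically smallest string with the same Parikh vector as x, and let i be the length of the longest common prefix of x and y. If x[i] ≠ x[n] (positions 1-indexed), then for every string s with BBWT(s) = rot(x) there exists k ≥ 0 such that rot^k(s) ≺ x. -/

import Mathlib

open List

variable {α : Type*} [LinearOrder α]

/-- A Lyndon word: nonempty and lexicographically strictly smaller than all of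
its proper nonempty suffixes. -/
def IsLyndon (w : List α) : Prop :=
  w ≠ [] ∧ ∀ i, 0 < i → i < w.length → w < w.drop i

/-- `fs` is the Lyndon factorization of `w` (factors listed with multiplicity,
so a necklace `f_i^{k_i}` contributes `k_i` copies of `f_i`): the factors
concatenate to `w`, each factor is Lyndon, and the sequence of factors is
lexicographically non-increasing. -/
def IsLyndonFactorization (w : List α) (fs : List (List α)) : Prop :=
  fs.flatten = w ∧ (∀ f ∈ fs, IsLyndon f) ∧ fs.Chain' (fun a b => b ≤ a)

/-- All cyclic rotations of `w` (with multiplicity). -/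
def rotations (w : List α) : List (List α) :=
  (List.range w.length).map fun i => w.drop i ++ w.take i

/-- The rotation moving the last character of `w` to the front. -/
def rotR (w : List α) : List α :=
  w.drop (w.length - 1) ++ w.take (w.length - 1)

/-- Number of maximal runs of equal consecutive characters of `s`. -/
def runCount (s : List α) : ℕ := (s.destutter (· ≠ ·)).length

/-- The Burrows–Wheeler transform: concatenation of the last characters of all
`|w|` cyclic rotations of `w`, listed in lexicographic order. -/
def BWT (w : List α) : List α :=
  (List.insertionSort (· ≤ ·) (rotations w)).flatMap fun r => r.getLast?.toList

/-- The ω-order comparison: `x ≼_ω y` iff `x^∞ ≤ y^∞`, equivalently `xy ≤ yx`. -/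
def omegaLE (x y : List α) : Prop := x ++ y ≤ y ++ x

instance : DecidableRel (omegaLE (α := α)) := fun x y =>
  inferInstanceAs (Decidable (x ++ y ≤ y ++ x))

/-- The bijective Burrows–Wheeler transform, expressed in terms of the Lyndon
factorization `fs` of a word: concatenation of the last characters of all
cyclic rotations of all Lyndon factors (with multiplicity), listed in ω-order. -/
def BBWTof (fs : List (List α)) : List α :=
  (List.insertionSort omegaLE (fs.flatMap rotations)).flatMap fun r => r.getLast?.toList

/-- Length of the longest common prefix of two strings. -/
def lcpLen : List α → List α → ℕ
  | a :: as, b :: bs => if a = b then lcpLen as bs + 1 else 0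
  | _, _ => 0

set_option linter.unusedSectionVars false

abbrev IW (α : Type*) := Lex (ℕ → α)

def icons (a : α) (g : IW α) : IW α := toLex fun k => Nat.casesOn k a (fun m => g m)

theorem icons_zero (a : α) (g : IW α) : icons a g 0 = a := rfl
theorem icons_succ (a : α) (g : IW α) (k : ℕ) : icons a g (k+1) = g k := rfl

theorem iw_lt {g h : IW α} : g < h ↔ ∃ m, (∀ j < m, g j = h j) ∧ g m < h m := Iff.rfl

theorem icons_eta (g : IW α) : ∃ h, g = icons (g 0) h := by
  refine ⟨toLex fun k => g (k+1), ?_⟩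
  funext k
  cases k <;> rfl

theorem icons_lt {a b : α} {g h : IW α} : icons a g < icons b h ↔ a < b ∨ a = b ∧ g < h := by
  rw [iw_lt, iw_lt]
  constructor
  · rintro ⟨m, h1, h2⟩
    cases m with
    | zero => exact Or.inl h2
    | succ m =>
      refine Or.inr ⟨h1 0 (by omega), m, fun j hj => h1 (j+1) (by omega), h2⟩
  · rintro (h1 | ⟨rfl, m, h1, h2⟩)
    · exact ⟨0, by simp, h1⟩
    · refine ⟨m+1, ?_, h2⟩
      intro j hj
      cases j with
      | zero => rfl
      | succ j => exact h1 j (by omega)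

theorem icons_inj {a b : α} {g h : IW α} : icons a g = icons b h ↔ a = b ∧ g = h := by
  constructor
  · intro e
    refine ⟨congrFun e 0, ?_⟩
    funext k
    exact congrFun e (k+1)
  · rintro ⟨rfl, rfl⟩; rfl

theorem icons_le {a b : α} {g h : IW α} : icons a g ≤ icons b h ↔ a < b ∨ a = b ∧ g ≤ h := by
  have e : g ≤ h ↔ g < h ∨ g = h := le_iff_lt_or_eq
  refine le_iff_lt_or_eq.trans ((or_congr icons_lt icons_inj).trans ?_)
  rw [e]
  tauto

def prep (l : List α) (g : IW α) : IW α := l.foldr icons g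

theorem prep_nil (g : IW α) : prep [] g = g := rfl
theorem prep_cons (a : α) (l : List α) (g : IW α) : prep (a :: l) g = icons a (prep l g) := rfl
theorem prep_append (l m : List α) (g : IW α) : prep (l ++ m) g = prep l (prep m g) := by
  simp [prep]

theorem prep_lt_list {l m : List α} (g h : IW α) (hlen : l.length = m.length) (hlt : l < m) :
    prep l g < prep m h := by
  induction l generalizing m with
  | nil => cases m <;> simp_all
  | cons a l ih =>
    cases m with
    | nil => simp at hlen
    | cons b m =>
      rw [prep_cons, prep_cons, icons_lt]
      rw [List.cons_lt_cons_iff] at hlt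
      rcases hlt with h1 | ⟨h1, h2⟩
      · exact Or.inl h1
      · exact Or.inr ⟨h1, ih (by simpa using hlen) h2⟩

theorem prep_strictMono (l : List α) {g h : IW α} (hlt : g < h) : prep l g < prep l h := by
  induction l with
  | nil => exact hlt
  | cons a l ih => rw [prep_cons, prep_cons, icons_lt]; exact Or.inr ⟨rfl, ih⟩

theorem prep_apply (d : α) (l : List α) (g : IW α) (k : ℕ) :
    prep l g k = if k < l.length then l.getD k d else g (k - l.length) := by
  induction l generalizing k with
  | nil => simp [prep]
  | cons a l ih =>
    rw [prep_cons]
    cases k with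
    | zero => simp [icons_zero]
    | succ k => rw [icons_succ, ih]; simp

def infw (d : α) (l : List α) : IW α := toLex fun k => l.getD (k % l.length) d

theorem infw_apply (d : α) (l : List α) (k : ℕ) : infw d l k = l.getD (k % l.length) d := rfl

theorem prep_infw (d : α) (l : List α) : prep l (infw d l) = infw d l := by
  funext k
  rw [prep_apply d, infw_apply, infw_apply]
  split_ifs with h
  · rw [Nat.mod_eq_of_lt h]
  · rw [← Nat.mod_eq_sub_mod (by omega)]

/-- agreement up to a first mismatch -/
theorem prep_agree (d : α) {l : List α} (hl : l ≠ []) (g : IW α) (m : ℕ)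
    (h : ∀ j < m, g j = prep l g j) : ∀ j ≤ m, prep l g j = infw d l j := by
  intro j
  induction j using Nat.strong_induction_on with
  | _ j ih =>
    intro hj
    have hpos := List.length_pos_iff.2 hl
    rw [← prep_infw d l, prep_apply d, prep_apply d]
    split_ifs with hlt
    · rfl
    · rw [h _ (by omega)]
      exact ih _ (by omega) (by omega)

theorem eq_infw (d : α) {l : List α} (hl : l ≠ []) {g : IW α} (h : g = prep l g) :
    g = infw d l := by
  funext k
  rw [← prep_agree d hl g k (fun j _ => congrFun h j) k le_rfl]
  exact congrFun h k

theorem lt_infw (d : α) {l : List α} (hl : l ≠ []) {g : IW α} (h : g < prep l g) :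
    g < infw d l := by
  obtain ⟨m, h1, h2⟩ := iw_lt.1 h
  have := prep_agree d hl g m h1
  exact iw_lt.2 ⟨m, fun j hj => by rw [h1 j hj, this j hj.le], by rw [← this m le_rfl]; exact h2⟩

theorem infw_lt (d : α) {l : List α} (hl : l ≠ []) {g : IW α} (h : prep l g < g) :
    infw d l < g := by
  obtain ⟨m, h1, h2⟩ := iw_lt.1 h
  have := prep_agree d hl g m (fun j hj => (h1 j hj).symm)
  exact iw_lt.2 ⟨m, fun j hj => by rw [← h1 j hj, this j hj.le], by rw [← this m le_rfl]; exact h2⟩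

theorem infw_lt_of_lt (d : α) {x y : List α} (hx : x ≠ []) (hy : y ≠ []) (h : x ++ y < y ++ x) :
    infw d x < infw d y := by
  have h1 := prep_lt_list (infw d y) (infw d y) (by simp [Nat.add_comm]) h
  rw [prep_append, prep_append, prep_infw] at h1
  exact infw_lt d hx (lt_infw d hy h1)

theorem infw_eq_of_eq (d : α) {x y : List α} (hx : x ≠ []) (hy : y ≠ []) (h : x ++ y = y ++ x) :
    infw d x = infw d y := by
  have h1 : prep (x ++ y) (infw d y) = prep (y ++ x) (infw d y) := by rw [h]
  rw [prep_append, prep_append, prep_infw] at h1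
  exact (eq_infw d hx (eq_infw d hy h1).symm).symm

theorem omegaLE_iff (d : α) {x y : List α} (hx : x ≠ []) (hy : y ≠ []) :
    omegaLE x y ↔ infw d x ≤ infw d y := by
  unfold omegaLE
  rcases lt_trichotomy (x ++ y) (y ++ x) with h | h | h
  · exact iff_of_true h.le (infw_lt_of_lt d hx hy h).le
  · exact iff_of_true h.le (infw_eq_of_eq d hx hy h).le
  · exact iff_of_false h.not_ge (infw_lt_of_lt d hy hx h).not_ge

theorem rotR_concat (l : List α) (b : α) : rotR (l ++ [b]) = b :: l := by
  simp [rotR]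

theorem infw_rotR (d : α) (l : List α) (b : α) :
    infw d (b :: l) = icons b (infw d (l ++ [b])) := by
  symm
  apply eq_infw d (by simp)
  have := prep_infw d (l ++ [b])
  rw [prep_append, prep_cons, prep_nil] at this
  rw [prep_cons, this]

theorem rotR_iter (l m : List α) : rotR^[m.length] (l ++ m) = m ++ l := by
  induction m using List.reverseRecOn generalizing l with
  | nil => simp
  | append_singleton m b ih =>
    rw [List.length_append, List.length_singleton, Function.iterate_succ_apply,
      ← List.append_assoc, rotR_concat, ← List.cons_append, ih]
    simp

theorem rotR_append_cons (l m : List α) (b : α) : rotR (m ++ (l ++ [b])) = b :: (m ++ l) := by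
  rw [← List.append_assoc, rotR_concat]

theorem rotations_rotR (f : List α) : ((rotations f).map rotR).Perm (rotations f) := by
  unfold rotations
  rw [List.map_map]
  rcases hn : f.length with _ | m
  · simp
  · rw [show (List.range (m+1)).map (fun i => f.drop i ++ f.take i) =
      (List.range m).map (fun i => f.drop i ++ f.take i) ++ [f.drop m ++ f.take m] by
        simp [List.range_succ]]
    rw [List.range_succ_eq_map, List.map_cons, List.map_map]
    have h0 : (rotR ∘ fun i => f.drop i ++ f.take i) 0 = f.drop m ++ f.take m := by
      simp [rotR, hn]
    have h1 : (List.range m).map ((rotR ∘ fun i => f.drop i ++ f.take i) ∘ Nat.succ) =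
        (List.range m).map (fun i => f.drop i ++ f.take i) := by
      apply List.map_congr_left
      intro i hi
      have hi' := List.mem_range.1 hi
      have hlt : i < f.length := by omega
      simp only [Function.comp, Nat.succ_eq_add_one]
      rw [List.take_succ_eq_append_getElem hlt, rotR_append_cons,
        List.drop_eq_getElem_cons hlt]
      rfl
    rw [h0, h1]
    exact (List.perm_append_singleton _ _).symm

theorem flatMap_rotations_rotR (fs : List (List α)) :
    ((fs.flatMap rotations).map rotR).Perm (fs.flatMap rotations) := by
  induction fs with
  | nil => simp
  | cons f fs ih =>
    rw [List.flatMap_cons, List.map_append]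
    exact (rotations_rotR f).append ih

theorem lcp_spec (x y : List α) (h : x.length = y.length) :
    x = y ∧ lcpLen x y = x.length ∨ ∃ p a u b v, x = p ++ a :: u ∧ y = p ++ b :: v ∧ a ≠ b ∧
      lcpLen x y = p.length := by
  induction x generalizing y with
  | nil => cases y <;> simp_all [lcpLen]
  | cons c x ih =>
    cases y with
    | nil => simp at h
    | cons e y =>
      by_cases hce : c = e
      · subst hce
        rcases ih y (by simpa using h) with ⟨h1, h2⟩ | ⟨p, a, u, b, v, h1, h2, h3, h4⟩
        · left; subst h1; simp [lcpLen, h2]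
        · right
          exact ⟨c :: p, a, u, b, v, by simp [h1], by simp [h2], h3, by simp [lcpLen, h4]⟩
      · right
        exact ⟨[], c, x, e, y, rfl, rfl, hce, by simp [lcpLen, hce]⟩

theorem list_cons_le {a b : α} {l m : List α} : a :: l ≤ b :: m ↔ a < b ∨ a = b ∧ l ≤ m := by
  have e : l ≤ m ↔ l < m ∨ l = m := le_iff_lt_or_eq
  have e2 : a :: l = b :: m ↔ a = b ∧ l = m := by simp
  refine le_iff_lt_or_eq.trans ((or_congr List.cons_lt_cons_iff e2).trans ?_)
  rw [e]
  tauto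

theorem list_nil_le (l : List α) : [] ≤ l := by
  refine le_iff_lt_or_eq.2 ?_
  cases l with
  | nil => exact Or.inr rfl
  | cons a l => exact Or.inl (List.nil_lt_cons a l)

theorem final_lt {f p z t u : List α} {a b : α} (hba : b < a) (hle : f ≤ p ++ b :: z)
    (hlen : f.length = (p ++ b :: z).length) : f ++ t < p ++ a :: u := by
  induction p generalizing f with
  | nil =>
    cases f with
    | nil => simp at hlen
    | cons h f =>
      simp only [List.nil_append, List.cons_append, list_cons_le,
        List.cons_lt_cons_iff] at *
      rcases hle with h1 | ⟨h1, -⟩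
      · exact Or.inl (h1.trans hba)
      · exact Or.inl (h1 ▸ hba)
  | cons c p ih =>
    cases f with
    | nil => simp at hlen
    | cons h f =>
      simp only [List.cons_append, list_cons_le, List.cons_lt_cons_iff] at *
      rcases hle with h1 | ⟨h1, h2⟩
      · exact Or.inl h1
      · exact Or.inr ⟨h1, ih h2 (by simpa using hlen)⟩

theorem lyndon_le_rot {f r : List α} (hf : IsLyndon f) (hr : r ∈ rotations f) :
    f ≤ r ∧ f.length = r.length := by
  simp only [rotations, List.mem_map, List.mem_range] at hr
  obtain ⟨i, hi, rfl⟩ := hr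
  constructor
  · rcases Nat.eq_zero_or_pos i with rfl | hpos
    · simp
    · have h1 : f ≤ f.drop i := (hf.2 i hpos hi).le
      refine le_trans h1 ?_
      generalize f.drop i = A
      induction A with
      | nil => exact list_nil_le _
      | cons a A ih => rw [List.cons_append, list_cons_le]; exact Or.inr ⟨rfl, ih⟩
  · simp; omega

theorem zip_mem {p : List α} {W : List (IW α)} {g : IW α} (h : g ∈ List.zipWith icons p W) :
    ∃ c ∈ p, ∃ w ∈ W, g = icons c w := by
  rw [List.mem_iff_getElem] at h
  obtain ⟨n, hn, rfl⟩ := h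
  rw [List.getElem_zipWith]
  exact ⟨_, List.getElem_mem _, _, List.getElem_mem _, rfl⟩

theorem icons_le_of_le {a b : α} {g h : IW α} (h1 : a ≤ b) (h2 : g ≤ h) : icons a g ≤ icons b h := by
  rw [icons_le]
  rcases h1.lt_or_eq with h1 | h1
  · exact Or.inl h1
  · exact Or.inr ⟨h1, h2⟩

theorem zip_sorted {p : List α} {W : List (IW α)} (hp : p.Pairwise (· ≤ ·))
    (hW : W.Pairwise (· ≤ ·)) : (List.zipWith icons p W).Pairwise (· ≤ ·) := by
  induction p generalizing W with
  | nil => simp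
  | cons a p ih =>
    cases W with
    | nil => simp
    | cons w W =>
      rw [List.pairwise_cons] at hp hW
      rw [List.zipWith_cons_cons, List.pairwise_cons]
      refine ⟨?_, ih hp.2 hW.2⟩
      intro g hg
      obtain ⟨c, hc, w', hw', rfl⟩ := zip_mem hg
      exact icons_le_of_le (hp.1 c hc) (hW.1 w' hw')

theorem sorted_prefix {A C W : List (IW α)} (hperm : (A ++ C).Perm W) (hW : W.Pairwise (· ≤ ·))
    (hA : A.Pairwise (· ≤ ·)) (hAC : ∀ a ∈ A, ∀ c ∈ C, a ≤ c) : ∃ C', W = A ++ C' := by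
  refine ⟨C.insertionSort (· ≤ ·), ?_⟩
  apply List.Perm.eq_of_pairwise (le := (· ≤ ·)) (fun a b _ _ h1 h2 => le_antisymm h1 h2) hW
  · rw [List.pairwise_append]
    refine ⟨hA, List.pairwise_insertionSort _ _, ?_⟩
    intro a ha c hc
    exact hAC a ha c (by simpa using hc)
  · exact hperm.symm.trans ((List.perm_insertionSort _ C).symm.append_left A)

theorem chain_lem (p : List α) (w : IW α) (Wa Wb C' : List (IW α)) (hlen : p.length = Wa.length)
    (h : w :: (Wa ++ Wb) = List.zipWith icons p Wa ++ C') :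
    ∃ e E, C' = e :: E ∧ w = prep p e := by
  induction p generalizing w Wa with
  | nil =>
    cases Wa with
    | nil => exact ⟨w, Wb, by simpa using h.symm, rfl⟩
    | cons _ _ => simp at hlen
  | cons c p ih =>
    cases Wa with
    | nil => simp at hlen
    | cons w' Wa =>
      simp only [List.zipWith_cons_cons, List.cons_append, List.cons.injEq] at h
      obtain ⟨e, E, h1, h2⟩ := ih w' Wa (by simpa using hlen) h.2
      exact ⟨e, E, h1, by rw [prep_cons, ← h2, h.1]⟩

theorem prep_prefix {l m : List α} {g h : IW α} (e : prep l g = prep m h) : l <+: m ∨ m <+: l := by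
  induction l generalizing m with
  | nil => exact Or.inl List.nil_prefix
  | cons a l ih =>
    cases m with
    | nil => exact Or.inr List.nil_prefix
    | cons b m =>
      rw [prep_cons, prep_cons, icons_inj] at e
      obtain ⟨rfl, e⟩ := e
      simpa [List.cons_prefix_cons] using ih e

theorem flatMap_getLast (d : α) (S : List (List α)) (h : ∀ r ∈ S, r ≠ []) :
    S.flatMap (fun r => r.getLast?.toList) = S.map (fun r => r.getLastD d) := by
  induction S with
  | nil => rfl
  | cons r S ih =>
    rw [List.flatMap_cons, List.map_cons, ih (fun q hq => h q (by simp [hq]))]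
    have := h r (by simp)
    rcases List.eq_nil_or_concat r with rfl | ⟨l, b, rfl⟩
    · exact absurd rfl this
    · simp

theorem zip_map (d : α) (S : List (List α)) (hB : ∀ r ∈ S, r ≠ []) :
    List.zipWith icons (S.map fun r => r.getLastD d) (S.map (infw d)) =
      (S.map rotR).map (infw d) := by
  induction S with
  | nil => rfl
  | cons r S ih =>
    rw [List.map_cons, List.map_cons, List.map_cons, List.map_cons, List.zipWith_cons_cons,
      ih (fun q hq => hB q (by simp [hq]))]
    have := hB r (by simp)
    rcases List.eq_nil_or_concat r with rfl | ⟨l, b, rfl⟩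
    · exact absurd rfl this
    · rw [List.concat_eq_append, rotR_concat, infw_rotR]; simp

/-- All the facts about the sorted list of rotations which are needed. -/
theorem bbwt_rows (d : α) (fs : List (List α)) (hfs : ∀ f ∈ fs, IsLyndon f) :
    ∃ S : List (List α), (∀ r ∈ S, r ≠ [] ∧ ∃ f ∈ fs, r ∈ rotations f) ∧
      BBWTof fs = S.map (fun r => r.getLastD d) ∧
      (S.map (infw d)).Pairwise (· ≤ ·) ∧
      (List.zipWith icons (BBWTof fs) (S.map (infw d))).Perm (S.map (infw d)) := by
  have hne : ∀ r ∈ fs.flatMap rotations, r ≠ [] ∧ ∃ f ∈ fs, r ∈ rotations f := by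
    intro r hr
    obtain ⟨f, hf, hr⟩ := List.mem_flatMap.1 hr
    refine ⟨?_, f, hf, hr⟩
    have h1 := (lyndon_le_rot (hfs f hf) hr).2
    have h2 := List.length_pos_iff.2 (hfs f hf).1
    exact List.length_pos_iff.1 (by omega)
  have hmem : ∀ r ∈ List.insertionSort omegaLE (fs.flatMap rotations),
      r ≠ [] ∧ ∃ f ∈ fs, r ∈ rotations f := by
    intro r hr
    exact hne r (by simpa only [List.mem_insertionSort] using hr)
  have hB : BBWTof fs = (List.insertionSort omegaLE (fs.flatMap rotations)).map
      (fun r => r.getLastD d) := flatMap_getLast d _ (fun r hr => (hmem r hr).1)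
  refine ⟨List.insertionSort omegaLE (fs.flatMap rotations), hmem, hB, ?_, ?_⟩
  · rw [List.map_insertionSort omegaLE (· ≤ ·) (infw d) _
      (fun a ha b hb => omegaLE_iff d (hne a ha).1 (hne b hb).1)]
    exact List.pairwise_insertionSort _ _
  · rw [hB, zip_map d _ (fun r hr => (hmem r hr).1)]
    apply List.Perm.map
    have hp := List.perm_insertionSort omegaLE (fs.flatMap rotations)
    exact ((hp.map rotR).trans (flatMap_rotations_rotR fs)).trans hp.symm

theorem heads_sorted {W : List (IW α)} (h : W.Pairwise (· ≤ ·)) :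
    (W.map fun g => g 0).Pairwise (· ≤ ·) := by
  rw [List.pairwise_map]
  refine h.imp ?_
  intro g h hgh
  obtain ⟨g', hg⟩ := icons_eta g
  obtain ⟨h', hh⟩ := icons_eta h
  rw [hg, hh, icons_le] at hgh
  rcases hgh with h1 | ⟨h1, -⟩
  · exact h1.le
  · exact h1.le

theorem zip_heads (p : List α) (W : List (IW α)) (hl : p.length = W.length) :
    (List.zipWith icons p W).map (fun g => g 0) = p := by
  induction p generalizing W with
  | nil => simp
  | cons a p ih =>
    cases W with
    | nil => simp at hl
    | cons w W => simp [icons_zero, ih W (by simpa using hl)]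

theorem inverse_bbwt_of_rotation_has_smaller_rotation (x : List α) (hx : x ≠ [])
    (hneck : ∀ u ∈ rotations x, x ≤ u)
    (i : ℕ) (hi : i = lcpLen x (List.insertionSort (· ≤ ·) x))
    (hcond : (x.take i).getLast? ≠ x.getLast?) :
    ∀ s fs, IsLyndonFactorization s fs → BBWTof fs = rotR x →
      ∃ k, rotR^[k] s < x := by
  intro s fs hfac hB
  obtain ⟨hs, hlyn, -⟩ := hfac
  have hyperm : (List.insertionSort (· ≤ ·) x).Perm x := List.perm_insertionSort _ x
  have hysort : (List.insertionSort (· ≤ ·) x).Pairwise (· ≤ ·) := List.pairwise_insertionSort _ x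
  generalize List.insertionSort (· ≤ ·) x = y at hi hyperm hysort
  rcases lcp_spec x y hyperm.length_eq.symm with ⟨-, h2⟩ | ⟨p, a, u, b, v, hxe, hye, hab, hl⟩
  · rw [h2] at hi
    exact absurd (by rw [hi, List.take_length]) hcond
  rw [hl] at hi
  have hpuv : (b :: v).Perm (a :: u) := by
    rw [hxe, hye, List.perm_append_left_iff] at hyperm
    exact hyperm
  rw [hye, List.pairwise_append] at hysort
  obtain ⟨hpsort, hbv, hpb⟩ := hysort
  have hba : b < a := by
    have : a ∈ b :: v := hpuv.mem_iff.2 (by simp)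
    rcases List.mem_cons.1 this with h | h
    · exact absurd h hab
    · exact lt_of_le_of_ne ((List.pairwise_cons.1 hbv).1 a h) (Ne.symm hab)
  have hpx : ∀ c ∈ p, ∀ e ∈ a :: u, c ≤ e := fun c hc e he => hpb c hc e (hpuv.mem_iff.2 he)
  -- the last letter of `x`
  obtain ⟨t, d, htd⟩ : ∃ t d, a :: u = t ++ [d] := by
    rcases List.eq_nil_or_concat (a :: u) with h | ⟨t, d, h⟩
    · simp at h
    · exact ⟨t, d, by simpa using h⟩
  have hxtd : x = (p ++ t) ++ [d] := by rw [hxe, htd, List.append_assoc]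
  have hpd : ∀ c ∈ p, c < d := by
    rcases List.eq_nil_or_concat p with rfl | ⟨q, c, rfl⟩
    · simp
    · rw [List.concat_eq_append] at *
      have hcd : c < d := by
        refine lt_of_le_of_ne (hpx c (by simp) d (by simp [htd])) ?_
        rintro rfl
        apply hcond
        have h1 : x.take i = q ++ [c] := by rw [hi, hxe, List.take_left]
        rw [h1, hxtd, List.getLast?_concat, List.getLast?_concat]
      intro c' hc'
      rcases List.mem_append.1 hc' with h | h
      · exact lt_of_le_of_lt ((List.pairwise_append.1 hpsort).2.2 c' h c (by simp)) hcd
      · rw [List.mem_singleton.1 h]; exact hcd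
  have hrot : rotR x = d :: (p ++ t) := by rw [hxtd, rotR_concat]
  obtain ⟨S, hS, hBS, hW, hperm⟩ := bbwt_rows d fs hlyn
  rw [hB, hrot] at hBS hperm
  cases S with
  | nil => simp at hBS
  | cons r S =>
  simp only [List.map_cons, List.cons.injEq] at hBS
  obtain ⟨hdr, hpt⟩ := hBS
  have hlen : S.length = p.length + t.length := by
    have := congrArg List.length hpt
    simpa using this.symm
  obtain ⟨Wa, Wb, hWab, hWal⟩ : ∃ Wa Wb, S.map (infw d) = Wa ++ Wb ∧ p.length = Wa.length :=
    ⟨(S.map (infw d)).take p.length, (S.map (infw d)).drop p.length,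
      (List.take_append_drop _ _).symm, by simp; omega⟩
  have hWbl : t.length = Wb.length := by
    have := congrArg List.length hWab
    simp at this
    omega
  have hheads : (List.map (infw d) (r :: S)).map (fun g => g 0) = p ++ b :: v := by
    apply List.Perm.eq_of_pairwise (le := (· ≤ ·)) (fun a b _ _ h1 h2 => le_antisymm h1 h2)
      (heads_sorted hW)
    · rw [List.pairwise_append]; exact ⟨hpsort, hbv, hpb⟩
    · refine ((hperm.map (fun g => g 0)).symm).trans ?_
      rw [zip_heads _ _ (by simp; omega)]
      rw [hye] at hyperm
      refine List.Perm.trans ?_ hyperm.symm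
      rw [hxtd]
      exact (List.perm_append_singleton _ _).symm
  rw [List.map_cons, hWab] at hW hperm hheads
  rw [List.zipWith_cons_cons, List.zipWith_append hWal] at hperm
  have hWs := List.pairwise_cons.1 hW
  have hWs2 := List.pairwise_append.1 hWs.2
  obtain ⟨C', hC'⟩ := sorted_prefix (A := List.zipWith icons p Wa)
    (C := icons d (infw d r) :: List.zipWith icons t Wb)
    (List.perm_middle.trans hperm) hW (zip_sorted hpsort hWs2.1) (by
      intro g hg g' hg'
      obtain ⟨c, hc, w, hw, rfl⟩ := zip_mem hg
      rcases List.mem_cons.1 hg' with rfl | hg'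
      · exact icons_le.2 (Or.inl (hpd c hc))
      · obtain ⟨c', hc', w', hw', rfl⟩ := zip_mem hg'
        exact icons_le_of_le (hpx c hc c' (by simp [htd, hc'])) (hWs2.2.2 w hw w' hw'))
  obtain ⟨e, E, hE, hre⟩ := chain_lem p _ Wa Wb C' hWal hC'
  have he0 : e 0 = b := by
    rw [hC', List.map_append, zip_heads _ _ hWal, hE, List.append_cancel_left_eq,
      List.map_cons, List.cons.injEq] at hheads
    exact hheads.1
  obtain ⟨e', he'⟩ := icons_eta e
  rw [he0] at he'
  have hpre : prep r (infw d r) = prep (p ++ [b]) e' := by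
    rw [prep_infw, hre, prep_append, prep_cons, prep_nil, he']
  obtain ⟨hrne, f, hf, hrf⟩ := hS r (by simp)
  have hpr : p ++ [b] <+: r := by
    rcases prep_prefix hpre with h | h
    · rcases List.prefix_concat_iff.1 h with h | h
      · rw [h]
      · exfalso
        have : d ∈ r := by
          rcases List.eq_nil_or_concat r with rfl | ⟨l, c, rfl⟩
          · exact absurd rfl hrne
          · simp at hdr; simp [hdr]
        exact lt_irrefl _ (hpd d (h.subset this))
    · exact h
  obtain ⟨z, hz⟩ := hpr
  have hz' : r = p ++ b :: z := by rw [← hz]; simp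
  obtain ⟨hfr, hfl⟩ := lyndon_le_rot (hlyn f hf) hrf
  rw [hz'] at hfr hfl
  obtain ⟨F, G, hFG⟩ := List.append_of_mem hf
  refine ⟨(f ++ G.flatten).length, ?_⟩
  rw [← hs, hFG, List.flatten_append, List.flatten_cons, rotR_iter, hxe, List.append_assoc]
  exact final_lt hba hfr hfl
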